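/- For every n ≥ 4 there is no maximal chain D of NCB_n such that every maximal chain C of NCB_n is contained, together with D, in some sublattice of NCB_n order-isomorphic to the Boolean lattice of all subsets of an n-element set. -/

import Mathlib

namespace NCPaper

/-- A partition (setoid) of `Fin m` is noncrossing if there are no indices
`a < b < c < d` with `a, c` in one block and `b, d` in a different block;
equivalently, crossing pairs must lie in the same block. Applied to `Fin (2*n)` with
the vertices of a regular `2n`-gon labelled `1, …, n, -1, …, -n` clockwise, this is
the type `B` noncrossing condition. -/
def IsNoncrossing {m : ℕ} (P : Setoid (Fin m)) : Prop :=
  ∀ a b c d : Fin m, a < b → b < c → c < d → P a c → P b d → P a b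

/-- Negation on the vertices of the `2n`-gon labelled `1, …, n, -1, …, -n` clockwise:
the antipodal map `x ↦ x + n (mod 2n)`. -/
def negB (n : ℕ) (x : Fin (2*n)) : Fin (2*n) :=
  ⟨(x.val + n) % (2*n), Nat.mod_lt _ (by have := x.isLt; omega)⟩

/-- A `B_n`-partition: it is invariant under negation (`B ∈ π ↔ -B ∈ π`) and has at
most one zero block (block `B` with `B = -B`). -/
def IsBnPartition {n : ℕ} (P : Setoid (Fin (2*n))) : Prop :=
  (∀ x y, P x y → P (negB n x) (negB n y)) ∧
  (∀ x y, P x (negB n x) → P y (negB n y) → P x y)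

/-- The lattice `NCB n` of noncrossing `B_n`-partitions, ordered by refinement. -/
def NCB (n : ℕ) : Type :=
  {P : Setoid (Fin (2*n)) // IsNoncrossing P ∧ IsBnPartition P}

instance (n : ℕ) : PartialOrder (NCB n) :=
  Subtype.partialOrder _

/-- A subset of a poset is closed under (binary) joins and meets of the ambient poset. -/
def LatClosed {α : Type*} [PartialOrder α] (L : Set α) : Prop :=
  (∀ x ∈ L, ∀ y ∈ L, ∀ z, IsLUB {x, y} z → z ∈ L) ∧
  (∀ x ∈ L, ∀ y ∈ L, ∀ z, IsGLB {x, y} z → z ∈ L)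

/-- `x < y` and `z` span a pentagon, witnessing a failure of the modular law. -/
def IsPentagon {α : Type*} [PartialOrder α] (x y z : α) : Prop :=
  x < y ∧ (∀ w, x ≤ w → z ≤ w → y ≤ w) ∧ ∀ w, w ≤ y → w ≤ z → w ≤ x

/-- Some pentagon has one of its two sides contained in `D`. -/
def Obstructed {α : Type*} [PartialOrder α] (D : Set α) : Prop :=
  ∃ x y z : α, IsPentagon x y z ∧ ((x ∈ D ∧ y ∈ D) ∨ z ∈ D)

theorem IsPentagon.map {α β : Type*} [PartialOrder α] [PartialOrder β] (e : α ≃o β) {x y z : α}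
    (h : IsPentagon x y z) : IsPentagon (e x) (e y) (e z) := by
  refine ⟨e.lt_iff_lt.2 h.1, fun w hx hz => ?_, fun w hy hz => ?_⟩
  · rw [← e.le_symm_apply] at *
    exact h.2.1 _ hx hz
  · rw [← e.symm_apply_le] at *
    exact h.2.2 _ hy hz

theorem Obstructed.of_image {α β : Type*} [PartialOrder α] [PartialOrder β] (e : α ≃o β)
    {D : Set α} (h : Obstructed (e '' D)) : Obstructed D := by
  obtain ⟨x, y, z, hp, h⟩ := h
  refine ⟨e.symm x, e.symm y, e.symm z, hp.map e.symm, ?_⟩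
  have key : ∀ w, w ∈ e '' D → e.symm w ∈ D := by
    rintro _ ⟨w, hw, rfl⟩
    simpa using hw
  exact h.imp (fun h => ⟨key _ h.1, key _ h.2⟩) (key _)

/-- A pentagon does not fit into a subset order-isomorphic to a Boolean lattice. -/
theorem IsPentagon.not_boolean {α ι : Type*} [PartialOrder α] {x y z : α} (h : IsPentagon x y z)
    {L : Set α} (hx : x ∈ L) (hy : y ∈ L) (hz : z ∈ L) (φ : L ≃o Set ι) : False := by
  have hsup : φ ⟨y, hy⟩ ≤ φ ⟨x, hx⟩ ⊔ φ ⟨z, hz⟩ := by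
    rw [← φ.le_symm_apply]
    refine h.2.1 _ ?_ ?_
    · exact (φ.le_symm_apply (x := ⟨x, hx⟩)).2 le_sup_left
    · exact (φ.le_symm_apply (x := ⟨z, hz⟩)).2 le_sup_right
  have hinf : φ ⟨y, hy⟩ ⊓ φ ⟨z, hz⟩ ≤ φ ⟨x, hx⟩ := by
    rw [← φ.symm_apply_le]
    refine h.2.2 _ ?_ ?_
    · exact (φ.symm_apply_le (x := ⟨y, hy⟩)).2 inf_le_left
    · exact (φ.symm_apply_le (x := ⟨z, hz⟩)).2 inf_le_right
  have hle : φ ⟨y, hy⟩ ≤ φ ⟨x, hx⟩ := by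
    intro i hi
    rcases hsup hi with h | h
    · exact h
    · exact hinf ⟨hi, h⟩
  exact absurd (φ.le_iff_le.1 hle) h.1.not_ge

theorem Obstructed.exists_maxChain {α ι : Type*} [PartialOrder α] {D : Set α}
    (h : Obstructed D) : ∃ C : Set α, IsMaxChain (· ≤ ·) C ∧
      ∀ L : Set α, C ∪ D ⊆ L → ¬ Nonempty (L ≃o Set ι) := by
  obtain ⟨x, y, z, hp, h | h⟩ := h
  · obtain ⟨C, hC, hsub⟩ := (IsChain.singleton (r := (· ≤ ·)) (a := z)).exists_maxChain
    refine ⟨C, hC, fun L hL ⟨φ⟩ => ?_⟩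
    exact hp.not_boolean (hL (.inr h.1)) (hL (.inr h.2)) (hL (.inl (hsub rfl))) φ
  · obtain ⟨C, hC, hsub⟩ := (IsChain.pair (r := (· ≤ ·)) hp.1.le).exists_maxChain
    refine ⟨C, hC, fun L hL ⟨φ⟩ => ?_⟩
    exact hp.not_boolean (hL (.inl (hsub (by simp)))) (hL (.inl (hsub (by simp))))
      (hL (.inr h)) φ

/-- In a finite poset, a non-maximal element of a maximal chain is covered by an element of
the chain. -/
theorem exists_covBy_of_isMaxChain {α : Type*} [PartialOrder α] [Finite α] {D : Set α}
    (hD : IsMaxChain (· ≤ ·) D) {x t : α} (hx : x ∈ D) (ht : t ∈ D) (hxt : x < t) :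
    ∃ y ∈ D, x ⋖ y := by
  obtain ⟨y, ⟨hy, hxy⟩, hmin⟩ := (Set.toFinite {y | y ∈ D ∧ x < y}).exists_minimal ⟨t, ht, hxt⟩
  refine ⟨y, hy, hxy, fun e hxe hey => ?_⟩
  have hle : ∀ d ∈ D, x < d → y ≤ d := fun d hd hxd =>
    (hD.1.total hy hd).elim id fun h => hmin ⟨hd, hxd⟩ h
  have hch : IsChain (· ≤ ·) (insert e D) := by
    refine hD.1.insert fun d hd _ => ?_
    by_cases hdx : x < d
    · exact .inl (hey.le.trans (hle d hd hdx))
    · right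
      rcases hD.1.total hx hd with h | h
      · rcases h.eq_or_lt with rfl | h
        · exact hxe.le
        · exact absurd h hdx
      · exact h.trans hxe.le
  have he : e ∈ D := by
    rw [hD.2 hch (Set.subset_insert _ _)]
    exact Set.mem_insert _ _
  exact absurd (hle e he hxe) hey.not_ge

theorem negB_val {n : ℕ} (x : Fin (2*n)) :
    (negB n x).val = if x.val < n then x.val + n else x.val - n := by
  have := x.isLt
  simp only [negB]
  split_ifs with h
  · exact Nat.mod_eq_of_lt (by omega)
  · rw [Nat.mod_eq_sub_mod (by omega), Nat.mod_eq_of_lt (by omega)]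
    omega

theorem negB_negB {n : ℕ} (x : Fin (2*n)) : negB n (negB n x) = x := by
  ext
  have := x.isLt
  simp only [negB_val]
  split_ifs <;> omega

namespace NCB

variable {n : ℕ}

theorem le_def {P Q : NCB n} : P ≤ Q ↔ ∀ a b, P.1 a b → Q.1 a b :=
  ⟨fun h a b => @h a b, fun h a b => h a b⟩

theorem rel_neg (P : NCB n) {a b : Fin (2*n)} (h : P.1 a b) : P.1 (negB n a) (negB n b) :=
  P.2.2.1 a b h

theorem rel_of_rel_neg (P : NCB n) {a b : Fin (2*n)} (h : P.1 (negB n a) (negB n b)) :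
    P.1 a b := by
  simpa only [negB_negB] using P.rel_neg h

theorem rel_of_cross (P : NCB n) {a b c d : Fin (2*n)} (hab : a < b) (hbc : b < c) (hcd : c < d)
    (hac : P.1 a c) (hbd : P.1 b d) : P.1 a b :=
  P.2.1 a b c d hab hbc hcd hac hbd

instance : Finite (NCB n) := by
  refine Finite.of_injective (fun P : NCB n => fun a b => P.1 a b) fun P Q h => ?_
  refine Subtype.ext (Setoid.ext fun a b => ?_)
  exact iff_of_eq (congrFun (congrFun h a) b)

instance : Min (NCB n) where
  min P Q := ⟨P.1 ⊓ Q.1, fun a b c d h₁ h₂ h₃ h₄ h₅ =>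
      ⟨P.2.1 a b c d h₁ h₂ h₃ h₄.1 h₅.1, Q.2.1 a b c d h₁ h₂ h₃ h₄.2 h₅.2⟩,
    fun x y h => ⟨P.2.2.1 x y h.1, Q.2.2.1 x y h.2⟩,
    fun x y h₁ h₂ => ⟨P.2.2.2 x y h₁.1 h₂.1, Q.2.2.2 x y h₁.2 h₂.2⟩⟩

/-- If `d` covers `c` and some pair is related in `d` but not in `c`, then `d` is below every
element above `c` relating that pair. -/
theorem le_of_covBy {c d X : NCB n} (h : c ⋖ d) (hcX : c ≤ X) {a b : Fin (2*n)}
    (hd : d.1 a b) (hc : ¬ c.1 a b) (hX : X.1 a b) : d ≤ X := by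
  have hlt : c < d ⊓ X := by
    refine lt_of_le_of_ne (le_def.2 fun u v huv => ⟨h.1.le huv, hcX huv⟩) ?_
    rintro rfl
    exact hc ⟨hd, hX⟩
  by_contra hdX
  refine h.2 hlt (lt_of_le_of_ne (le_def.2 fun u v huv => huv.1) fun heq => hdX ?_)
  rw [← heq]
  exact le_def.2 fun u v huv => huv.2

/-- The partition whose only possibly nontrivial block is the symmetric set `S`. -/
def zeroBlock (S : Fin (2*n) → Prop) (hS : ∀ x, S x → S (negB n x)) : NCB n :=
  ⟨{ r := fun a b => a = b ∨ (S a ∧ S b)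
     iseqv := ⟨fun _ => .inl rfl, by grind, by grind⟩ }, by
    have hne : ∀ x : Fin (2*n), x ≠ negB n x := fun x h => by
      have h' := congrArg Fin.val h
      rw [negB_val] at h'
      have := x.isLt
      split_ifs at h' <;> omega
    refine ⟨?_, ?_, ?_⟩
    · rintro a b c d hab hbc hcd (h | h) (h' | h')
      · omega
      · omega
      · omega
      · exact .inr ⟨h.1, h'.1⟩
    · rintro x y (rfl | h)
      · exact .inl rfl
      · exact .inr ⟨hS _ h.1, hS _ h.2⟩
    · rintro x y (h | h) (h' | h')
      · exact absurd h (hne x)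
      · exact absurd h (hne x)
      · exact absurd h' (hne y)
      · exact .inr ⟨h.1, h'.1⟩⟩

/-- The partition with zero block `{p, q, -p, -q}` and all other blocks trivial. -/
def zeroPair (p q : Fin (2*n)) : NCB n :=
  zeroBlock (fun x => x = p ∨ x = negB n p ∨ x = q ∨ x = negB n q) (by
    rintro x (rfl | rfl | rfl | rfl) <;> simp [negB_negB])

theorem zeroPair_rel {p q a b : Fin (2*n)} : (zeroPair p q).1 a b ↔
    a = b ∨ ((a = p ∨ a = negB n p ∨ a = q ∨ a = negB n q) ∧
      (b = p ∨ b = negB n p ∨ b = q ∨ b = negB n q)) := Iff.rfl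

theorem zeroPair_le {p q : Fin (2*n)} {P : NCB n} (h₁ : P.1 p (negB n p)) (h₂ : P.1 p q) :
    zeroPair p q ≤ P := by
  have key : ∀ x, (x = p ∨ x = negB n p ∨ x = q ∨ x = negB n q) → P.1 p x := by
    rintro x (rfl | rfl | rfl | rfl)
    · exact P.1.refl _
    · exact h₁
    · exact h₂
    · exact P.1.trans h₁ (P.rel_neg h₂)
  refine le_def.2 fun a b h => ?_
  rcases h with rfl | h
  · exact P.1.refl _
  · exact P.1.trans (P.1.symm (key a h.1)) (key b h.2)

/-- The partition given by the fibres of a labelling. -/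
def ofLabel (f : Fin (2*n) → ℕ)
    (hc : ∀ a b c d : Fin (2*n), a < b → b < c → c < d → f a = f c → f b = f d → f a = f b)
    (hn : ∀ x y, f x = f y → f (negB n x) = f (negB n y))
    (hz : ∀ x y, f x = f (negB n x) → f y = f (negB n y) → f x = f y) : NCB n :=
  ⟨Setoid.ker f, hc, hn, hz⟩

theorem zeroPair_inf_eq {d : NCB n} {p q : Fin (2*n)} (h₁ : ¬ d.1 p q) (h₂ : ¬ d.1 p (negB n p))
    (h₃ : ¬ d.1 p (negB n q)) (h₄ : ¬ d.1 q (negB n q)) {a b : Fin (2*n)} (hd : d.1 a b)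
    (h : (zeroPair p q).1 a b) : a = b := by
  have h₁' := fun h => h₁ (d.rel_of_rel_neg h)
  have h₃' : ¬ d.1 (negB n p) q := fun h => h₃ (by simpa only [negB_negB] using d.rel_neg h)
  have hs := fun {a b} (h : d.1 a b) => d.1.symm h
  rcases h with h | ⟨rfl | rfl | rfl | rfl, rfl | rfl | rfl | rfl⟩ <;> first | assumption | rfl | skip
  all_goals first | exact absurd hd ‹_› | exact absurd (hs hd) ‹_›

/-- A labelling whose fibres are `{p, q}`, `{-p, -q}` and singletons. -/
def pairLabel (n p q a : ℕ) : ℕ :=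
  if a = q then p else if a + n = q ∨ a = q + n then p + n else a

theorem pairLabel_eq_iff {n p q a c : ℕ} (hp : p < n) (hpq : p < q) (hq : q < p + n)
    (ha : a < 2*n) (hac : a < c) (hc : c < 2*n) : pairLabel n p q a = pairLabel n p q c ↔
      (a = p ∧ c = q) ∨ (a + n = q ∧ c = p + n) ∨ (a = p + n ∧ c = q + n) := by
  unfold pairLabel
  split_ifs <;> omega

/-- The partition with blocks `{p, q}`, `{-p, -q}` and all other blocks trivial. -/
def pairBlock (p q : Fin (2*n)) (hp : p.val < n) (hpq : p < q) (hq : q.val < p.val + n) : NCB n :=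
  ofLabel (fun a => pairLabel n p q a)
    (by
      intro a b c d hab hbc hcd h₁ h₂
      rw [pairLabel_eq_iff hp hpq hq (by omega) (by omega) (by omega)] at h₁ h₂
      rw [Fin.lt_def] at *
      omega)
    (by
      intro x y h
      wlog hxy : x < y generalizing x y
      · rcases (not_lt.1 hxy).eq_or_lt with rfl | hyx
        · rfl
        · exact (this y x h.symm hyx).symm
      have := x.isLt
      have := y.isLt
      rw [pairLabel_eq_iff hp hpq hq (by omega) (by omega) (by omega)] at h
      rw [Fin.lt_def] at hpq hxy
      rw [negB_val, negB_val, pairLabel, pairLabel]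
      rcases h with h | h | h <;> split_ifs <;> omega)
    (by
      intro x y h
      have := x.isLt
      rw [Fin.lt_def] at hpq
      simp only [negB_val, pairLabel] at *
      split_ifs at * <;> omega)

theorem pairBlock_rel {p q : Fin (2*n)} {hp : p.val < n} {hpq : p < q} {hq : q.val < p.val + n}
    {a b : Fin (2*n)} :
    (pairBlock p q hp hpq hq).1 a b ↔ pairLabel n p q a = pairLabel n p q b := Iff.rfl

instance : OrderBot (NCB n) where
  bot := zeroBlock (fun _ => False) (fun _ h => h)
  bot_le P := le_def.2 fun _ _ h => by
    rcases h with rfl | h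
    · exact P.1.refl _
    · exact h.1.elim

instance : OrderTop (NCB n) where
  top := zeroBlock (fun _ => True) (fun _ h => h)
  le_top _ := le_def.2 fun _ _ _ => .inr ⟨trivial, trivial⟩

theorem bot_rel {a b : Fin (2*n)} : (⊥ : NCB n).1 a b ↔ a = b := by
  change a = b ∨ (False ∧ False) ↔ a = b
  tauto

theorem exists_rel_of_lt {c d : NCB n} (h : c < d) : ∃ a b, d.1 a b ∧ ¬ c.1 a b := by
  by_contra! hcon
  exact h.not_ge (le_def.2 hcon)

theorem rel_neg_comm (P : NCB n) {a b : Fin (2*n)} (h : P.1 a (negB n b)) : P.1 (negB n a) b := by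
  simpa only [negB_negB] using P.rel_neg h

/-- Two related points may be chosen in increasing order and less than half a turn apart. -/
theorem exists_rel_lt {c d : NCB n} (hd : ∀ a, ¬ d.1 a (negB n a)) {a b : Fin (2*n)}
    (hab : d.1 a b) (hc : ¬ c.1 a b) :
    ∃ x y : Fin (2*n), x < y ∧ y.val < x.val + n ∧ d.1 x y ∧ ¬ c.1 x y := by
  wlog hlt : a < b generalizing a b
  · refine this (d.1.symm hab) (fun h => hc (c.1.symm h)) ?_
    refine lt_of_le_of_ne (not_lt.1 hlt) ?_
    rintro rfl
    exact hc (c.1.refl _)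
  have hne : b ≠ negB n a := by
    rintro rfl
    exact hd _ hab
  rw [Ne, Fin.ext_iff] at hne
  have hv := negB_val a
  have hv' := negB_val b
  have := a.isLt
  have := b.isLt
  rw [Fin.lt_def] at hlt
  by_cases h : b.val < a.val + n
  · exact ⟨a, b, hlt, h, hab, hc⟩
  · refine ⟨negB n b, negB n a, ?_, ?_, d.rel_neg (d.1.symm hab),
      fun h => hc (c.1.symm (c.rel_of_rel_neg h))⟩
    · rw [Fin.lt_def]
      split_ifs at * <;> omega
    · split_ifs at * <;> omega

theorem obstructed_of_zero {D : Set (NCB n)} {d : NCB n} (hdD : d ∈ D) {p a q : Fin (2*n)}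
    (hpn : p.val < n) (hpa : p < a) (haq : a < q) (hq : q.val < p.val + n)
    (ha : d.1 a (negB n a)) (h₁ : ¬ d.1 p q) (h₂ : ¬ d.1 p (negB n p))
    (h₃ : ¬ d.1 p (negB n q)) (h₄ : ¬ d.1 q (negB n q)) : Obstructed D := by
  have hpq := hpa.trans haq
  have hrel : (pairBlock p q hpn hpq hq).1 p q := by
    rw [pairBlock_rel]
    simp only [pairLabel, Fin.lt_def] at *
    split_ifs <;> omega
  have hle : pairBlock p q hpn hpq hq ≤ zeroPair p q := by
    refine le_def.2 fun u v h => ?_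
    rw [pairBlock_rel, pairLabel, pairLabel] at h
    rw [zeroPair_rel]
    have := u.isLt
    have := v.isLt
    simp only [negB_val, Fin.ext_iff, Fin.lt_def] at *
    split_ifs at * <;> omega
  have hnrel : ¬ (pairBlock p q hpn hpq hq).1 p (negB n p) := by
    rw [pairBlock_rel]
    simp only [pairLabel, negB_val, Fin.lt_def] at *
    split_ifs <;> omega
  refine ⟨pairBlock p q hpn hpq hq, zeroPair p q, d, ⟨?_, ?_, ?_⟩, .inr hdD⟩
  · refine lt_of_le_not_ge hle fun h => hnrel (h ?_)
    exact .inr ⟨.inl rfl, .inr (.inl rfl)⟩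
  · intro w hcw hdw
    have hwpq := hcw hrel
    have hwa := hdw ha
    have hwpa : w.1 p a := by
      have hv := negB_val a
      split_ifs at hv with h
      · refine w.rel_of_cross hpa haq ?_ hwpq hwa
        rw [Fin.lt_def] at *
        omega
      · have := w.rel_of_cross (a := negB n a) (b := p) (c := a) (d := q)
          (by rw [Fin.lt_def] at *; omega) hpa haq (w.1.symm hwa) hwpq
        exact w.1.trans (w.1.symm this) (w.1.symm hwa)
    exact zeroPair_le (w.1.trans hwpa (w.1.trans hwa (w.rel_neg (w.1.symm hwpa)))) hwpq
  · intro w hw hwd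
    refine le_def.2 fun u v h => ?_
    rw [zeroPair_inf_eq h₁ h₂ h₃ h₄ (hwd h) (hw h)]

theorem rel_of_not_obstructed {D : Set (NCB n)} (hD : ¬ Obstructed D) {d : NCB n} (hdD : d ∈ D)
    (hd : ∀ a, ¬ d.1 a (negB n a)) {x t y : Fin (2*n)} (hxt : x < t) (hty : t < y)
    (hyx : y.val < x.val + n) (hxy : d.1 x y) : d.1 x t := by
  by_contra hnt
  have cross : ∀ w : NCB n, w.1 x y → w.1 t (negB n t) → w.1 x t := by
    intro w h h'
    have hv := negB_val t
    split_ifs at hv with ht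
    · refine w.rel_of_cross hxt hty ?_ h h'
      rw [Fin.lt_def] at *
      omega
    · have := w.rel_of_cross (a := negB n t) (b := x) (c := t) (d := y)
        (by rw [Fin.lt_def] at *; omega) hxt hty (w.1.symm h') h
      exact w.1.trans (w.1.symm this) (w.1.symm h')
  have hnt' : ¬ d.1 t (negB n x) := by
    intro h
    have hv := negB_val x
    split_ifs at hv with hx
    · refine hnt (d.rel_of_cross hxt hty ?_ hxy h)
      rw [Fin.lt_def] at *
      omega
    · have := d.rel_of_cross (a := negB n x) (b := x) (c := t) (d := y)
        (by rw [Fin.lt_def] at *; omega) hxt hty (d.1.symm h) hxy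
      exact hd x (d.1.symm this)
  refine hD ⟨zeroPair t t, zeroPair t x, d, ⟨?_, ?_, ?_⟩, .inr hdD⟩
  · refine lt_of_le_not_ge ?_ fun h => ?_
    · exact zeroPair_le (.inr ⟨.inl rfl, .inr (.inl rfl)⟩) ((zeroPair t x).1.refl _)
    · have h' : (zeroPair t t).1 t x := h (.inr ⟨.inl rfl, .inr (.inr (.inl rfl))⟩)
      rw [zeroPair_rel] at h'
      have := x.isLt
      simp only [negB_val, Fin.ext_iff, Fin.lt_def] at *
      split_ifs at h' <;> omega
  · intro w hcw hdw
    have h : w.1 t (negB n t) := hcw (.inr ⟨.inl rfl, .inr (.inl rfl)⟩)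
    exact zeroPair_le h (w.1.symm (cross w (hdw hxy) h))
  · intro w hw hwd
    refine le_def.2 fun u v h => ?_
    rw [zeroPair_inf_eq (fun h => hnt (d.1.symm h)) (hd t) hnt' (hd x) (hwd h) (hw h)]

/-- Rotation of the `2n`-gon by `k` steps. -/
def shift (k : Fin (2*n)) (x : Fin (2*n)) : Fin (2*n) :=
  ⟨if x.val + k.val < 2*n then x.val + k.val else x.val + k.val - 2*n, by
    have := x.isLt
    have := k.isLt
    split_ifs <;> omega⟩

theorem shift_negB (k x : Fin (2*n)) : shift k (negB n x) = negB n (shift k x) := by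
  have := x.isLt
  have := k.isLt
  simp only [Fin.ext_iff, shift, negB_val]
  split_ifs <;> omega

theorem exists_shift_eq (a b : Fin (2*n)) : ∃ k, shift k a = b := by
  have := a.isLt
  have := b.isLt
  refine ⟨⟨if a ≤ b then b.val - a.val else b.val + 2*n - a.val, ?_⟩, ?_⟩
  · split_ifs with h <;> rw [Fin.le_def] at h <;> omega
  · simp only [Fin.ext_iff, shift, Fin.le_def]
    split_ifs <;> omega

theorem exists_shift_inverse (k : Fin (2*n)) :
    ∃ l : Fin (2*n), (∀ x, shift k (shift l x) = x) ∧ ∀ x, shift l (shift k x) = x := by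
  have := k.isLt
  refine ⟨⟨if k.val = 0 then 0 else 2*n - k.val, by split_ifs <;> omega⟩, fun x => ?_, fun x => ?_⟩
  all_goals
    have := x.isLt
    simp only [Fin.ext_iff, shift]
    split_ifs <;> omega

/-- The partition obtained from `P` by rotation. -/
def rotate (k : Fin (2*n)) (P : NCB n) : NCB n :=
  ⟨Setoid.comap (shift k) P.1, by
    refine ⟨fun a b c d hab hbc hcd hac hbd => ?_, fun x y h => ?_, fun x y hx hy => ?_⟩
    · change P.1 (shift k a) (shift k c) at hac
      change P.1 (shift k b) (shift k d) at hbd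
      change P.1 (shift k a) (shift k b)
      have hs : ∀ x y, x < y → shift k x < shift k y ∨ (y.val + k.val ≥ 2*n ∧ x.val + k.val < 2*n ∧
          shift k y < shift k x) := by
        intro x y hxy
        have := y.isLt
        simp only [Fin.lt_def, shift] at *
        split_ifs <;> omega
      have hda : 2*n ≤ d.val + k.val → a.val + k.val < 2*n → shift k d < shift k a := by
        intro h h'
        have := d.isLt
        simp only [Fin.lt_def, shift] at *
        split_ifs <;> omega
      rw [Fin.lt_def] at hab hbc hcd
      rcases hs a b hab with h₁ | h₁
      · rcases hs b c hbc with h₂ | h₂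
        · rcases hs c d hcd with h₃ | h₃
          · exact P.rel_of_cross h₁ h₂ h₃ hac hbd
          · have := P.rel_of_cross (hda (by omega) (by omega)) h₁ h₂ (P.1.symm hbd) hac
            exact P.1.trans (P.1.symm this) (P.1.symm hbd)
        · rcases hs c d hcd with h₃ | h₃
          · exact P.1.trans hac (P.1.trans (P.rel_of_cross h₃ (hda (by omega) (by omega)) h₁
              (P.1.symm hac) (P.1.symm hbd)) (P.1.symm hbd))
          · omega
      · rcases hs b c hbc with h₂ | h₂
        · rcases hs c d hcd with h₃ | h₃
          · have := P.rel_of_cross h₂ h₃ (hda (by omega) (by omega)) hbd (P.1.symm hac)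
            exact P.1.trans hac (P.1.symm this)
          · omega
        · omega
    · change P.1 (shift k (negB n x)) (shift k (negB n y))
      rw [shift_negB, shift_negB]
      exact P.rel_neg h
    · change P.1 (shift k x) (shift k (negB n x)) at hx
      change P.1 (shift k y) (shift k (negB n y)) at hy
      rw [shift_negB] at hx hy
      exact P.2.2.2 _ _ hx hy⟩

theorem rotate_rel {k : Fin (2*n)} {P : NCB n} {a b : Fin (2*n)} :
    (rotate k P).1 a b ↔ P.1 (shift k a) (shift k b) := Iff.rfl

theorem exists_rotate_equiv (k : Fin (2*n)) : ∃ e : NCB n ≃o NCB n, ∀ P, e P = rotate k P := by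
  obtain ⟨l, hl, hl'⟩ := exists_shift_inverse k
  have inv : ∀ k l : Fin (2*n), (∀ x, shift k (shift l x) = x) →
      ∀ P : NCB n, rotate l (rotate k P) = P := fun k l h P =>
    Subtype.ext (Setoid.ext fun a b => by
      change P.1 _ _ ↔ _
      rw [h, h])
  have mono : ∀ (k : Fin (2*n)) {P Q : NCB n}, P ≤ Q → rotate k P ≤ rotate k Q :=
    fun k P Q h => le_def.2 fun a b hab => h hab
  refine ⟨⟨⟨rotate k, rotate l, inv k l hl, inv l k hl'⟩, fun {P Q} => ⟨fun h => ?_, mono k⟩⟩,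
    fun P => rfl⟩
  have := mono l h
  simpa only [Equiv.coe_fn_mk, inv k l hl] using this

theorem obstructed_of_atom_zero (hn : 3 ≤ n) {D : Set (NCB n)} {d : NCB n} (hdD : d ∈ D)
    (hd : ⊥ ⋖ d) {a : Fin (2*n)} (ha : d.1 a (negB n a)) : Obstructed D := by
  obtain ⟨i, hi⟩ : ∃ i : Fin (2*n), i.val = 1 := ⟨⟨1, by omega⟩, rfl⟩
  obtain ⟨k, hk⟩ := exists_shift_eq i a
  obtain ⟨e, he⟩ := exists_rotate_equiv k
  refine Obstructed.of_image e ?_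
  have hed : (e d).1 i (negB n i) := by
    rw [he, rotate_rel, shift_negB, hk]
    exact ha
  have hbot : ⊥ ⋖ e d := by
    rw [← map_bot e]
    exact (apply_covBy_apply_iff e).2 hd
  have hle : e d ≤ zeroPair i i := by
    refine le_of_covBy hbot bot_le hed ?_ (.inr ⟨.inl rfl, .inr (.inl rfl)⟩)
    rw [bot_rel, Fin.ext_iff, negB_val]
    split_ifs <;> omega
  obtain ⟨p, hp⟩ : ∃ p : Fin (2*n), p.val = 0 := ⟨⟨0, by omega⟩, rfl⟩
  obtain ⟨q, hq⟩ : ∃ q : Fin (2*n), q.val = 2 := ⟨⟨2, by omega⟩, rfl⟩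
  refine obstructed_of_zero (Set.mem_image_of_mem e hdD) (p := p) (a := i) (q := q) (by omega)
    (by rw [Fin.lt_def]; omega) (by rw [Fin.lt_def]; omega) (by omega) hed ?_ ?_ ?_ ?_
  all_goals
    intro h
    have h' := hle h
    rw [zeroPair_rel] at h'
    simp only [Fin.ext_iff, negB_val] at h'
    split_ifs at h' <;> omega

/-- A labelling of the interval partition with blocks `{0, 1}`, `{j, j + 1}` (merged if `j = 1`)
and their negatives. -/
def stepLabel (n j a : ℕ) : ℕ :=
  if a < n then a - (if 1 ≤ a then 1 else 0) - (if j + 1 ≤ a then 1 else 0)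
  else n + (a - n - (if n + 1 ≤ a then 1 else 0) - (if n + j + 1 ≤ a then 1 else 0))

theorem stepLabel_monotone {j : ℕ} (h₁ : 1 ≤ j) (h₂ : j + 2 ≤ n) : Monotone (stepLabel n j) := by
  refine monotone_nat_of_le_succ fun a => ?_
  unfold stepLabel
  split_ifs <;> omega

/-- The partition whose blocks are the fibres of `stepLabel`. -/
def twoSteps (j : ℕ) (h₁ : 1 ≤ j) (h₂ : j + 2 ≤ n) : NCB n :=
  have hneg : ∀ x : Fin (2*n), stepLabel n j (negB n x) =
      if stepLabel n j x < n then stepLabel n j x + n else stepLabel n j x - n := by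
    intro x
    have := x.isLt
    simp only [stepLabel, negB_val]
    split_ifs <;> omega
  ofLabel (fun a => stepLabel n j a) (fun a b c d hab hbc hcd h _ =>
      (stepLabel_monotone h₁ h₂ hab.le).antisymm (h ▸ stepLabel_monotone h₁ h₂ hbc.le))
    (fun x y h => by rw [hneg, hneg, h])
    (fun x y h => by
      rw [hneg] at h
      split_ifs at h <;> omega)

theorem twoSteps_rel {j : ℕ} {h₁ : 1 ≤ j} {h₂ : j + 2 ≤ n} {a b : Fin (2*n)} :
    (twoSteps j h₁ h₂).1 a b ↔ stepLabel n j a = stepLabel n j b := Iff.rfl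

theorem stepLabel_eq {j a b : ℕ} (h₁ : 1 ≤ j) (h₂ : j + 2 ≤ n) (hab : a < b)
    (h : stepLabel n j a = stepLabel n j b) :
    (b = a + 1 ∧ (a = 0 ∨ a = j ∨ a = n ∨ a = n + j)) ∨
      (b = a + 2 ∧ j = 1 ∧ (a = 0 ∨ a = n)) := by
  unfold stepLabel at h
  split_ifs at h <;> omega

/-- A labelling of the partition with blocks `{±1, …, ±j}`, `{j + 1, …, n}` and
`{-(j + 1), …, -n}`. -/
def splitLabel (n j a : ℕ) : ℕ :=
  if a = 0 then 2 else if a ≤ j then 0 else if a ≤ n then 1 else if a ≤ n + j then 0 else 2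

theorem splitLabel_spec (j a : ℕ) :
    (splitLabel n j a = 0 ∧ (1 ≤ a ∧ a ≤ j ∨ n < a ∧ a ≤ n + j)) ∨
      (splitLabel n j a = 1 ∧ j < a ∧ a ≤ n) ∨
      (splitLabel n j a = 2 ∧ (a = 0 ∨ n + j < a)) := by
  unfold splitLabel
  split_ifs <;> omega

theorem splitLabel_negB {j : ℕ} (h₁ : 1 ≤ j) (h₂ : j + 2 ≤ n) (x : Fin (2*n)) :
    splitLabel n j (negB n x) = if splitLabel n j x = 0 then 0 else 3 - splitLabel n j x := by
  have := x.isLt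
  simp only [splitLabel, negB_val]
  split_ifs <;> omega

/-- The coatom whose blocks are the fibres of `splitLabel`. -/
def splitting (j : ℕ) (h₁ : 1 ≤ j) (h₂ : j + 2 ≤ n) : NCB n :=
  ofLabel (fun a => splitLabel n j a)
    (by
      intro a b c d hab hbc hcd h h'
      rw [Fin.lt_def] at *
      rcases splitLabel_spec (n := n) j a with ha | ha | ha <;>
        rcases splitLabel_spec (n := n) j c with hc | hc | hc <;>
        first
        | omega
        | rcases splitLabel_spec (n := n) j b with hb | hb | hb <;>
            rcases splitLabel_spec (n := n) j d with hd | hd | hd <;> omega)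
    (fun x y h => by rw [splitLabel_negB h₁ h₂, splitLabel_negB h₁ h₂, h])
    (fun x y h h' => by
      rw [splitLabel_negB h₁ h₂] at h h'
      split_ifs at h h' <;> omega)

theorem splitting_rel {j : ℕ} {h₁ : 1 ≤ j} {h₂ : j + 2 ≤ n} {a b : Fin (2*n)} :
    (splitting j h₁ h₂).1 a b ↔ splitLabel n j a = splitLabel n j b := Iff.rfl

theorem eq_top_of_splitting_le {j : ℕ} (h₁ : 1 ≤ j) (h₂ : j + 2 ≤ n) {w : NCB n}
    (hw : splitting j h₁ h₂ ≤ w) {a b : Fin (2*n)} (hab : w.1 a b)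
    (ha : splitLabel n j a = 0) (hb : splitLabel n j b ≠ 0) : w = ⊤ := by
  have hle : ∀ x : Fin (2*n), splitLabel n j x ≤ 2 := by
    intro x
    unfold splitLabel
    split_ifs <;> omega
  have haa : w.1 a (negB n a) := hw (by
    rw [splitting_rel, splitLabel_negB h₁ h₂, ha]
    rfl)
  have key : ∀ u, w.1 a u := by
    intro u
    by_cases hu : splitLabel n j u = 0
    · exact hw (by rw [splitting_rel, ha, hu])
    by_cases hub : splitLabel n j u = splitLabel n j b
    · exact w.1.trans hab (hw (by rw [splitting_rel, hub]))
    · refine w.1.trans haa (w.rel_neg_comm (w.1.trans hab (hw ?_)))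
      rw [splitting_rel, splitLabel_negB h₁ h₂, if_neg hu]
      have := hle u
      have := hle b
      omega
  exact top_le_iff.1 (le_def.2 fun u v _ => w.1.trans (w.1.symm (key u)) (key v))

theorem obstructed_of_le_twoSteps {D : Set (NCB n)} {c d : NCB n} (hcD : c ∈ D) (hdD : d ∈ D)
    {j : ℕ} (h₁ : 1 ≤ j) (h₂ : j + 2 ≤ n) (hcd : c < d) (hd : d ≤ twoSteps j h₁ h₂)
    {a b : Fin (2*n)} (hab : c.1 a b) (ha : splitLabel n j a = 0) (hb : splitLabel n j b ≠ 0) :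
    Obstructed D := by
  refine ⟨c, d, splitting j h₁ h₂, ⟨hcd, fun w hcw hw => ?_, fun w hwd hw => ?_⟩, .inl ⟨hcD, hdD⟩⟩
  · rw [eq_top_of_splitting_le h₁ h₂ hw (hcw hab) ha hb]
    exact le_top
  · have key : ∀ u v, u < v → ¬ w.1 u v := by
      intro u v huv h
      have hu := stepLabel_eq h₁ h₂ huv (twoSteps_rel.1 (hd (hwd h)))
      have hv := splitting_rel.1 (hw h)
      simp only [splitLabel] at hv
      split_ifs at hv <;> omega
    refine le_def.2 fun u v h => ?_
    rcases lt_trichotomy u v with huv | rfl | huv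
    · exact absurd h (key u v huv)
    · exact c.1.refl _
    · exact absurd (w.1.symm h) (key v u huv)

theorem obstructed_of_zero_rank_two (hn : 4 ≤ n) {D : Set (NCB n)} {c d : NCB n} (hdD : d ∈ D)
    (hcd : c ⋖ d) (hc : ∀ a, ¬ c.1 a (negB n a)) {o i : Fin (2*n)} (ho : o.val = 0)
    (hi : i.val = 1) (hoi : c.1 o i) (hle : ∀ P : NCB n, P.1 o i → c ≤ P) {a : Fin (2*n)}
    (ha : d.1 a (negB n a)) : Obstructed D := by
  by_cases h0 : d.1 o (negB n o)
  · have hdX : d ≤ zeroPair o i :=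
      le_of_covBy hcd (hle _ (.inr ⟨.inl rfl, .inr (.inr (.inl rfl))⟩)) h0 (hc o)
        (.inr ⟨.inl rfl, .inr (.inl rfl)⟩)
    obtain ⟨p, hp⟩ : ∃ p : Fin (2*n), p.val = n - 1 := ⟨⟨n - 1, by omega⟩, rfl⟩
    obtain ⟨q, hq⟩ : ∃ q : Fin (2*n), q.val = n + 2 := ⟨⟨n + 2, by omega⟩, rfl⟩
    have hv : (negB n o).val = n := by
      rw [negB_val]
      split_ifs <;> omega
    refine obstructed_of_zero hdD (p := p) (a := negB n o) (q := q) (by omega)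
      (by rw [Fin.lt_def]; omega) (by rw [Fin.lt_def]; omega) (by omega) (d.rel_neg h0)
      ?_ ?_ ?_ ?_
    all_goals
      intro h
      have h' := hdX h
      rw [zeroPair_rel] at h'
      simp only [Fin.ext_iff, negB_val] at h'
      split_ifs at h' <;> omega
  · have hi0 : ¬ d.1 i (negB n i) := fun h =>
      h0 (d.1.trans (hcd.1.le hoi) (d.1.trans h (d.rel_neg (d.1.symm (hcd.1.le hoi)))))
    wlog han : a.val < n generalizing a
    · refine this (d.rel_neg ha) ?_
      have := a.isLt
      rw [negB_val]
      split_ifs; omega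
    have ha0 : a.val ≠ 0 := fun h => by
      obtain rfl : a = o := Fin.ext (h.trans ho.symm)
      exact h0 ha
    have ha1 : a.val ≠ 1 := fun h => by
      obtain rfl : a = i := Fin.ext (h.trans hi.symm)
      exact hi0 ha
    let S : Fin (2*n) → Prop := fun x =>
      x = o ∨ x = negB n o ∨ x = i ∨ x = negB n i ∨ x = a ∨ x = negB n a
    have hS : ∀ x, S x → S (negB n x) := by
      rintro x (rfl | rfl | rfl | rfl | rfl | rfl) <;> simp [S, negB_negB]
    have hdX : d ≤ zeroBlock S hS :=
      le_of_covBy hcd (hle _ (.inr ⟨.inl rfl, .inr (.inr (.inl rfl))⟩)) ha (hc a)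
        (.inr ⟨by simp [S], by simp [S]⟩)
    obtain ⟨p, hp⟩ : ∃ p : Fin (2*n), p.val = a.val - 1 := ⟨⟨a.val - 1, by omega⟩, rfl⟩
    obtain ⟨q, hq⟩ : ∃ q : Fin (2*n), q.val = a.val + 1 := ⟨⟨a.val + 1, by omega⟩, rfl⟩
    have hnX : ∀ {u v}, u ≠ v → d.1 u v → S u ∧ S v := fun hne h => (hdX h).resolve_left hne
    have hpS : S p → p = i := by
      intro h
      simp only [S, Fin.ext_iff, negB_val] at h ⊢
      split_ifs at h <;> omega
    have hqS : S q → q = negB n o := by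
      intro h
      simp only [S, Fin.ext_iff, negB_val] at h ⊢
      split_ifs at h ⊢ <;> omega
    have hpq : S p → ¬ S q := by
      intro h h'
      have e₁ := congrArg Fin.val (hpS h)
      have e₂ := congrArg Fin.val (hqS h')
      rw [negB_val] at e₂
      split_ifs at e₂ <;> omega
    refine obstructed_of_zero hdD (p := p) (a := a) (q := q) (by omega)
      (by rw [Fin.lt_def]; omega) (by rw [Fin.lt_def]; omega) (by omega) ha ?_ ?_ ?_ ?_
    · intro h
      have := hnX (by rw [Ne, Fin.ext_iff]; omega) h
      exact hpq this.1 this.2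
    · intro h
      by_cases hSp : S p
      · rw [hpS hSp] at h
        exact hi0 h
      · refine hSp (hnX ?_ h).1
        rw [Ne, Fin.ext_iff, negB_val]
        split_ifs <;> omega
    · intro h
      have := hnX (by rw [Ne, Fin.ext_iff, negB_val]; split_ifs <;> omega) h
      exact hpq this.1 (by simpa only [negB_negB] using hS _ this.2)
    · intro h
      by_cases hSq : S q
      · rw [hqS hSq] at h
        exact h0 (d.rel_of_rel_neg h)
      · refine hSq (hnX ?_ h).1
        rw [Ne, Fin.ext_iff, negB_val]
        split_ifs <;> omega

/-- A related pair of neighbours outside the class of `{0, 1}`. -/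
theorem exists_neighbours {c d : NCB n} (hcd : c < d) (hd : ∀ a, ¬ d.1 a (negB n a))
    (hconv : ∀ x t y : Fin (2*n), x < t → t < y → y.val < x.val + n → d.1 x y → d.1 x t)
    {o i : Fin (2*n)} (ho : o.val = 0) (hi : i.val = 1) (hoi : c.1 o i) (hn : 2 ≤ n) :
    ∃ a b : Fin (2*n), 1 ≤ a.val ∧ a.val < n ∧ b.val = a.val + 1 ∧ d.1 a b := by
  suffices h : ∃ a b : Fin (2*n), a.val ≠ 0 ∧ a.val ≠ n ∧ b.val = a.val + 1 ∧ d.1 a b by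
    obtain ⟨a, b, ha0, han, hb, hab⟩ := h
    by_cases h : a.val < n
    · exact ⟨a, b, by omega, h, hb, hab⟩
    · have := b.isLt
      refine ⟨negB n a, negB n b, ?_, ?_, ?_, d.rel_neg hab⟩
      all_goals
        simp only [negB_val]
        split_ifs <;> omega
  obtain ⟨x, y, hxy, hc⟩ := exists_rel_of_lt hcd
  obtain ⟨x, y, hlt, hyn, hxy, hc⟩ := exists_rel_lt hd hxy hc
  have hconv' : ∀ t : Fin (2*n), x < t → t ≤ y → d.1 x t := by
    intro t hxt hty
    rcases hty.eq_or_lt with rfl | hty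
    · exact hxy
    · exact hconv x t y hxt hty hyn hxy
  have := y.isLt
  rw [Fin.lt_def] at hlt
  obtain ⟨t, ht⟩ : ∃ t : Fin (2*n), t.val = x.val + 1 := ⟨⟨x.val + 1, by omega⟩, rfl⟩
  have hxt := hconv' t (by rw [Fin.lt_def]; omega) (by rw [Fin.le_def]; omega)
  by_cases hx : x.val ≠ 0 ∧ x.val ≠ n
  · exact ⟨x, t, hx.1, hx.2, ht, hxt⟩
  have hty : t ≠ y := by
    rintro rfl
    by_cases hx0 : x.val = 0
    · obtain rfl : x = o := Fin.ext (by omega)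
      obtain rfl : t = i := Fin.ext (by omega)
      exact hc hoi
    · obtain rfl : x = negB n o := Fin.ext (by rw [negB_val]; split_ifs <;> omega)
      obtain rfl : t = negB n i := Fin.ext (by rw [negB_val] at *; split_ifs at * <;> omega)
      exact hc (c.rel_neg hoi)
  rw [Ne, Fin.ext_iff] at hty
  obtain ⟨s, hs⟩ : ∃ s : Fin (2*n), s.val = x.val + 2 := ⟨⟨x.val + 2, by omega⟩, rfl⟩
  have hxs := hconv' s (by rw [Fin.lt_def]; omega) (by rw [Fin.le_def]; omega)
  exact ⟨t, s, by omega, by omega, by omega, d.1.trans (d.1.symm hxt) hxs⟩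

theorem obstructed_of_rank_two (hn : 4 ≤ n) {D : Set (NCB n)} {c d : NCB n} (hcD : c ∈ D)
    (hdD : d ∈ D) (hc : ⊥ ⋖ c) (hcd : c ⋖ d) {o i : Fin (2*n)} (ho : o.val = 0)
    (hi : i.val = 1) (hoi : c.1 o i) : Obstructed D := by
  by_contra hO
  have hcz : ∀ a, ¬ c.1 a (negB n a) := fun a ha =>
    hO (obstructed_of_atom_zero (by omega) hcD hc ha)
  have hle : ∀ P : NCB n, P.1 o i → c ≤ P := fun P hP =>
    le_of_covBy hc bot_le hoi (by rw [bot_rel, Fin.ext_iff]; omega) hP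
  have hdz : ∀ a, ¬ d.1 a (negB n a) := fun a ha =>
    hO (obstructed_of_zero_rank_two hn hdD hcd hcz ho hi hoi hle ha)
  obtain ⟨a, b, ha, han, hb, hab⟩ := exists_neighbours hcd.1 hdz
    (fun x t y hxt hty hyn h => rel_of_not_obstructed hO hdD hdz hxt hty hyn h) ho hi hoi
    (by omega)
  have hnc : ¬ c.1 a b := fun h => by
    have h' := hle (pairBlock o i (by omega) (by rw [Fin.lt_def]; omega) (by omega)) (by
      rw [pairBlock_rel]
      simp only [pairLabel]
      split_ifs <;> omega) h
    rw [pairBlock_rel, pairLabel_eq_iff (by omega) (by omega) (by omega) (by omega) (by omega)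
      (by omega)] at h'
    omega
  by_cases h2 : a.val + 2 ≤ n
  · have hstep : ∀ u v : Fin (2*n), v.val = u.val + 1 → (u.val = 0 ∨ u.val = a.val) →
        (twoSteps a.val ha h2).1 u v := by
      intro u v hv hu
      rw [twoSteps_rel]
      simp only [stepLabel]
      split_ifs <;> omega
    have hd2 := le_of_covBy hcd (hle _ (hstep o i (by omega) (.inl ho))) hab hnc
      (hstep a b hb (.inr rfl))
    refine hO (obstructed_of_le_twoSteps hcD hdD ha h2 hcd.1 hd2 (c.1.symm hoi) ?_ ?_)
    · unfold splitLabel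
      split_ifs <;> omega
    · unfold splitLabel
      split_ifs
      omega
  · obtain ⟨k, hk⟩ := exists_shift_eq o a
    obtain ⟨e, he⟩ := exists_rotate_equiv k
    have hkv : k.val = a.val := by
      have := congrArg Fin.val hk
      simp only [shift] at this
      split_ifs at this <;> omega
    have hki : shift k i = b := Fin.ext (by simp only [shift]; split_ifs <;> omega)
    obtain ⟨t, ht⟩ : ∃ t : Fin (2*n), t.val = 2 := ⟨⟨2, by omega⟩, rfl⟩
    have hkt : shift k t = negB n i :=
      Fin.ext (by simp only [shift, negB_val]; split_ifs <;> omega)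
    have hki' : shift k i = negB n o :=
      hki.trans (Fin.ext (by rw [negB_val]; split_ifs <;> omega))
    have hstep : ∀ u v : Fin (2*n), v.val = u.val + 1 → (u.val = 0 ∨ u.val = 1) →
        (twoSteps 1 le_rfl (by omega : 1 + 2 ≤ n)).1 u v := by
      intro u v hv hu
      rw [twoSteps_rel]
      simp only [stepLabel]
      split_ifs <;> omega
    have hit : (e c).1 i t := by
      rw [he, rotate_rel, hki', hkt]
      exact c.rel_neg hoi
    have hec : e c ≤ twoSteps 1 le_rfl (by omega) := by
      rw [← e.le_symm_apply]
      refine hle _ (rel_of_rel_neg _ ?_)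
      have key : (e (e.symm (twoSteps 1 le_rfl (by omega)))).1 i t := by
        rw [e.apply_symm_apply]
        exact hstep i t (by omega) (.inr hi)
      rwa [he, rotate_rel, hki', hkt] at key
    have hed : e d ≤ twoSteps 1 le_rfl (by omega) := by
      refine le_of_covBy ((apply_covBy_apply_iff e).2 hcd) hec (a := o) (b := i) ?_ ?_
        (hstep o i (by omega) (.inl ho))
      · rw [he, rotate_rel, hk, hki]
        exact hab
      · rw [he, rotate_rel, hk, hki]
        exact hnc
    refine hO (Obstructed.of_image e (obstructed_of_le_twoSteps (Set.mem_image_of_mem e hcD)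
      (Set.mem_image_of_mem e hdD) le_rfl (by omega) (e.lt_iff_lt.2 hcd.1) hed hit ?_ ?_))
    · unfold splitLabel
      split_ifs <;> omega
    · unfold splitLabel
      split_ifs <;> omega

theorem obstructed_of_isMaxChain (hn : 4 ≤ n) {D : Set (NCB n)} (hD : IsMaxChain (· ≤ ·) D) :
    Obstructed D := by
  by_contra hO
  obtain ⟨o, ho⟩ : ∃ o : Fin (2*n), o.val = 0 := ⟨⟨0, by omega⟩, rfl⟩
  obtain ⟨i, hi⟩ : ∃ i : Fin (2*n), i.val = 1 := ⟨⟨1, by omega⟩, rfl⟩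
  have top_rel : ∀ a b, (⊤ : NCB n).1 a b := fun a b => .inr ⟨trivial, trivial⟩
  have hbt : (⊥ : NCB n) < ⊤ := by
    refine lt_of_le_not_ge bot_le fun h => ?_
    have := bot_rel.1 (h (top_rel o i))
    omega
  obtain ⟨c, hcD, hc⟩ := exists_covBy_of_isMaxChain hD hD.bot_mem hD.top_mem hbt
  have hcz : ∀ a, ¬ c.1 a (negB n a) := fun a ha =>
    hO (obstructed_of_atom_zero (by omega) hcD hc ha)
  have hct : c < ⊤ := by
    refine lt_of_le_not_ge le_top fun h => ?_
    exact hcz o (h (top_rel _ _))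
  obtain ⟨d, hdD, hcd⟩ := exists_covBy_of_isMaxChain hD hcD hD.top_mem hct
  obtain ⟨x, y, hxy, hne⟩ := exists_rel_of_lt hc.1
  obtain ⟨x, y, hlt, hyn, hxy, -⟩ := exists_rel_lt hcz hxy hne
  have := y.isLt
  rw [Fin.lt_def] at hlt
  obtain ⟨t, ht⟩ : ∃ t : Fin (2*n), t.val = x.val + 1 := ⟨⟨x.val + 1, by omega⟩, rfl⟩
  have hxt : c.1 x t := by
    by_cases hty : t = y
    · rwa [hty]
    · rw [Fin.ext_iff] at hty
      exact rel_of_not_obstructed hO hcD hcz (by rw [Fin.lt_def]; omega)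
        (by rw [Fin.lt_def]; omega) hyn hxy
  obtain ⟨k, hk⟩ := exists_shift_eq o x
  obtain ⟨e, he⟩ := exists_rotate_equiv k
  have hkt : shift k i = t := by
    have hkv := congrArg Fin.val hk
    refine Fin.ext ?_
    simp only [shift] at *
    split_ifs at * <;> omega
  refine hO (Obstructed.of_image e (obstructed_of_rank_two hn (Set.mem_image_of_mem e hcD)
    (Set.mem_image_of_mem e hdD) ?_ ((apply_covBy_apply_iff e).2 hcd) ho hi ?_))
  · rw [← map_bot e]
    exact (apply_covBy_apply_iff e).2 hc
  · rw [he, rotate_rel, hk, hkt]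
    exact hxt

end NCB

/-- for `n ≥ 4` there is no maximal chain `D` of `NCB n` such that every
maximal chain `C` lies, together with `D`, in a common sublattice of `NCB n`
order-isomorphic to the Boolean lattice of all subsets of an `n`-element set. -/
theorem NCB_no_universal_chain (n : ℕ) (hn : 4 ≤ n) :
    ¬ ∃ D : Set (NCB n), IsMaxChain (· ≤ ·) D ∧
        ∀ C : Set (NCB n), IsMaxChain (· ≤ ·) C →
          ∃ L : Set (NCB n), C ∪ D ⊆ L ∧ LatClosed L ∧
            Nonempty (↥L ≃o Set (Fin n)) := by
  rintro ⟨D, hD, h⟩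
  obtain ⟨C, hC, hCL⟩ := (NCB.obstructed_of_isMaxChain hn hD).exists_maxChain (ι := Fin n)
  obtain ⟨L, hL, -, hiso⟩ := h C hC
  exact hCL L hL hiso

end NCPaper
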